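/- Let A be an n×n Hermitian matrix (n ≥ 1) over the complex numbers and let B be the principal (n−1)×(n−1) submatrix of A obtained by deleting the last row and last column. Then the eigenvalues of B interlace the eigenvalues of A; that is, if r₁ ≤ r₂ ≤ ... ≤ rₙ are the eigenvalues of A (with multiplicity) and s₁ ≤ s₂ ≤ ... ≤ s₍ₙ₋₁₎ are the eigenvalues of B (with multiplicity), then r₁ ≤ s₁ ≤ r₂ ≤ s₂ ≤ ... ≤ s₍ₙ₋₁₎ ≤ rₙ. -/

import Mathlib

open scoped InnerProductSpace

/-- Two finite families with the same multiset of values differ by a permutation of the indices. -/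
theorem exists_perm_of_univ_val_map_eq {ι α : Type*} [Fintype ι] {f g : ι → α}
    (h : (Finset.univ : Finset ι).val.map f = Finset.univ.val.map g) :
    ∃ σ : Equiv.Perm ι, ∀ i, g (σ i) = f i := by
  classical
  have e (c : α) : Nonempty ({i // f i = c} ≃ {i // g i = c}) := by
    rw [← Fintype.card_eq, Fintype.card_subtype, Fintype.card_subtype]
    have hc := congrArg (Multiset.count c) h
    simpa [Multiset.count_map, Finset.card_def, eq_comm] using hc
  exact ⟨Equiv.ofFiberEquiv fun c => (e c).some, fun i => Equiv.ofFiberEquiv_map _ i⟩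

/-- A Hermitian matrix has an orthonormal eigenbasis compatible with any enumeration of
the roots of its characteristic polynomial. -/
theorem Matrix.IsHermitian.exists_orthonormalBasis_of_roots_charpoly {ι : Type*} [Fintype ι]
    [DecidableEq ι] {A : Matrix ι ι ℂ} (hA : A.IsHermitian) {r : ι → ℝ}
    (hr : A.charpoly.roots = Finset.univ.val.map fun i => (r i : ℂ)) :
    ∃ b : OrthonormalBasis ι ℂ (EuclideanSpace ℂ ι),
      ∀ i, A.toEuclideanLin (b i) = (r i : ℂ) • b i := by
  obtain ⟨σ, hσ⟩ := exists_perm_of_univ_val_map_eq (hr.symm.trans hA.roots_charpoly_eq_eigenvalues)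
  refine ⟨hA.eigenvectorBasis.reindex σ.symm, fun i => ?_⟩
  rw [← hσ i, OrthonormalBasis.reindex_apply, Equiv.symm_symm, Matrix.toLpLin_apply,
    hA.mulVec_eigenvectorBasis]
  ext j
  simp

section Compression

variable {V W ι κ : Type*} [NormedAddCommGroup V] [InnerProductSpace ℂ V]
  [NormedAddCommGroup W] [InnerProductSpace ℂ W] [Fintype ι] [Fintype κ]

/-- The quadratic form of a symmetric operator in an orthonormal eigenbasis. -/
theorem LinearMap.IsSymmetric.inner_apply_self_eq_sum {T : V →ₗ[ℂ] V} (hT : T.IsSymmetric)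
    (b : OrthonormalBasis ι ℂ V) {r : ι → ℝ} (hb : ∀ i, T (b i) = (r i : ℂ) • b i) (x : V) :
    (⟪x, T x⟫_ℂ).re = ∑ i, r i * ‖⟪b i, x⟫_ℂ‖ ^ 2 := by
  rw [← b.sum_inner_mul_inner x (T x), Complex.re_sum]
  refine Finset.sum_congr rfl fun i _ => ?_
  have h : (⟪x, b i⟫_ℂ * ⟪b i, x⟫_ℂ).re = ‖⟪x, b i⟫_ℂ * ⟪b i, x⟫_ℂ‖ :=
    inner_mul_symm_re_eq_norm (𝕜 := ℂ) x (b i)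
  rw [← hT (b i) x, hb, inner_smul_left, Complex.conj_ofReal, mul_left_comm,
    Complex.re_ofReal_mul, h, norm_mul, norm_inner_symm x, sq]

/-- Comparison of eigenvalues of a symmetric operator and of its compression along an isometry:
index sets of total size exceeding the dimension of the big space force an inequality. -/
theorem le_of_card_lt_of_compression {T : V →ₗ[ℂ] V} (hT : T.IsSymmetric)
    {S : W →ₗ[ℂ] W} (hS : S.IsSymmetric) (J : W →ₗᵢ[ℂ] V)
    (hJ : ∀ x, ⟪J x, T (J x)⟫_ℂ = ⟪x, S x⟫_ℂ)
    (b : OrthonormalBasis ι ℂ V) {r : ι → ℝ} (hb : ∀ i, T (b i) = (r i : ℂ) • b i)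
    (c : OrthonormalBasis κ ℂ W) {s : κ → ℝ} (hc : ∀ i, S (c i) = (s i : ℂ) • c i)
    (P : Finset ι) (Q : Finset κ) (hcard : Fintype.card ι < P.card + Q.card) {u v : ℝ}
    (hP : ∀ i ∈ P, u ≤ r i) (hQ : ∀ i ∈ Q, s i ≤ v) : u ≤ v := by
  classical
  have : FiniteDimensional ℂ W := c.toBasis.finiteDimensional_of_finite
  let F : W →ₗ[ℂ] ({i // i ∉ P} → ℂ) × ({i // i ∉ Q} → ℂ) :=
    (LinearMap.pi fun i : {i // i ∉ P} => (innerₛₗ ℂ (b i)).comp J.toLinearMap).prod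
      (LinearMap.pi fun i : {i // i ∉ Q} => innerₛₗ ℂ (c i))
  have hF : LinearMap.ker F ≠ ⊥ := by
    apply LinearMap.ker_ne_bot_of_finrank_lt
    have h₁ := P.card_le_univ
    have h₂ := Q.card_le_univ
    rw [Module.finrank_eq_card_basis c.toBasis, Module.finrank_prod,
      Module.finrank_fintype_fun_eq_card, Module.finrank_fintype_fun_eq_card,
      Fintype.card_subtype_compl, Fintype.card_subtype_compl, Fintype.card_coe, Fintype.card_coe]
    omega
  obtain ⟨x, hx, hx0⟩ := (Submodule.ne_bot_iff _).mp hF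
  have hx' := Prod.mk.inj (LinearMap.mem_ker.mp hx)
  have hxP (i : ι) (hi : i ∉ P) : ⟪b i, J x⟫_ℂ = 0 := congrFun hx'.1 ⟨i, hi⟩
  have hxQ (i : κ) (hi : i ∉ Q) : ⟪c i, x⟫_ℂ = 0 := congrFun hx'.2 ⟨i, hi⟩
  have lower : u * ‖x‖ ^ 2 ≤ (⟪x, S x⟫_ℂ).re := by
    rw [← hJ, hT.inner_apply_self_eq_sum b hb, ← J.norm_map x, ← b.sum_sq_norm_inner_right,
      Finset.mul_sum]
    refine Finset.sum_le_sum fun i _ => ?_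
    by_cases hi : i ∈ P
    · gcongr
      exact hP i hi
    · simp [hxP i hi]
  have upper : (⟪x, S x⟫_ℂ).re ≤ v * ‖x‖ ^ 2 := by
    rw [hS.inner_apply_self_eq_sum c hc, ← c.sum_sq_norm_inner_right, Finset.mul_sum]
    refine Finset.sum_le_sum fun i _ => ?_
    by_cases hi : i ∈ Q
    · gcongr
      exact hQ i hi
    · simp [hxQ i hi]
  exact le_of_mul_le_mul_right (lower.trans upper) (by positivity)

end Compression

/-- The inclusion of `ℂⁿ` into `ℂⁿ⁺¹` as the vectors with last coordinate zero. -/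
noncomputable def EuclideanSpace.snocZero (n : ℕ) :
    EuclideanSpace ℂ (Fin n) →ₗᵢ[ℂ] EuclideanSpace ℂ (Fin (n + 1)) where
  toFun x := WithLp.toLp 2 (Fin.snoc (α := fun _ => ℂ) x 0)
  map_add' x y := by
    ext i
    refine Fin.lastCases ?_ (fun i => ?_) i <;> simp
  map_smul' a x := by
    ext i
    refine Fin.lastCases ?_ (fun i => ?_) i <;> simp
  norm_map' x := by
    simp [EuclideanSpace.norm_eq, Fin.sum_univ_castSucc]

@[simp]
theorem EuclideanSpace.snocZero_castSucc {n : ℕ} (x : EuclideanSpace ℂ (Fin n)) (i : Fin n) :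
    EuclideanSpace.snocZero n x i.castSucc = x i := by
  simp [EuclideanSpace.snocZero]

@[simp]
theorem EuclideanSpace.snocZero_last {n : ℕ} (x : EuclideanSpace ℂ (Fin n)) :
    EuclideanSpace.snocZero n x (Fin.last n) = 0 := by
  simp [EuclideanSpace.snocZero]

theorem EuclideanSpace.inner_snocZero_toEuclideanLin {n : ℕ}
    (A : Matrix (Fin (n + 1)) (Fin (n + 1)) ℂ) (x : EuclideanSpace ℂ (Fin n)) :
    ⟪snocZero n x, A.toEuclideanLin (snocZero n x)⟫_ℂ =
      ⟪x, (A.submatrix Fin.castSucc Fin.castSucc).toEuclideanLin x⟫_ℂ := by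
  simp [PiLp.inner_apply, Fin.sum_univ_castSucc, Matrix.toLpLin_apply, Matrix.mulVec, dotProduct]

/-- **Cauchy interlace theorem.** If `A` is an `(n+1) × (n+1)` Hermitian complex matrix
and `B` is the principal submatrix obtained by deleting the last row and column, then
the eigenvalues of `B` (listed in nondecreasing order with multiplicity, as the roots of
the characteristic polynomial) interlace those of `A`. -/
theorem cauchy_interlace
    (n : ℕ) (A : Matrix (Fin (n + 1)) (Fin (n + 1)) ℂ) (hA : A.IsHermitian)
    (B : Matrix (Fin n) (Fin n) ℂ) (hB : B = A.submatrix Fin.castSucc Fin.castSucc)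
    (r : Fin (n + 1) → ℝ) (hr : Monotone r)
    (hrA : A.charpoly.roots = Finset.univ.val.map fun i => (r i : ℂ))
    (s : Fin n → ℝ) (hs : Monotone s)
    (hsB : B.charpoly.roots = Finset.univ.val.map fun i => (s i : ℂ)) :
    ∀ i : Fin n, r i.castSucc ≤ s i ∧ s i ≤ r i.succ := by
  intro i
  have hBH : B.IsHermitian := hB ▸ hA.submatrix Fin.castSucc
  obtain ⟨b, hb⟩ := hA.exists_orthonormalBasis_of_roots_charpoly hrA
  obtain ⟨c, hc⟩ := hBH.exists_orthonormalBasis_of_roots_charpoly hsB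
  have hT := Matrix.isSymmetric_toEuclideanLin_iff.mpr hA
  have hS := Matrix.isSymmetric_toEuclideanLin_iff.mpr hBH
  have hJ (x) := EuclideanSpace.inner_snocZero_toEuclideanLin A x
  rw [← hB] at hJ
  constructor
  · refine le_of_card_lt_of_compression hT hS (EuclideanSpace.snocZero n) hJ b hb c hc
      (Finset.Ici i.castSucc) (Finset.Iic i) ?_ (fun j hj => hr (Finset.mem_Ici.mp hj))
      (fun j hj => hs (Finset.mem_Iic.mp hj))
    simp only [Fin.card_Ici, Fin.card_Iic, Fintype.card_fin, Fin.val_castSucc]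
    omega
  · refine neg_le_neg_iff.mp <| le_of_card_lt_of_compression (r := -r) (s := -s)
      (T := -A.toEuclideanLin) (S := -B.toEuclideanLin)
      (fun x y => by simp [hT x y]) (fun x y => by simp [hS x y])
      (EuclideanSpace.snocZero n) (fun x => by simp [hJ x]) b (fun j => by simp [hb j])
      c (fun j => by simp [hc j]) (Finset.Iic i.succ) (Finset.Ici i) ?_
      (fun j hj => neg_le_neg (hr (Finset.mem_Iic.mp hj)))
      (fun j hj => neg_le_neg (hs (Finset.mem_Ici.mp hj)))
    simp only [Fin.card_Ici, Fin.card_Iic, Fintype.card_fin, Fin.val_succ]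
    omega
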